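/- Existence of near-linear-size hypergraph cut sparsifiers: There exists a universal constant C > 0 such that for every weighted hypergraph H = (V, E, w) with |V| = n ≥ 2, rank r ≥ 2, and nonnegative weights, and every ε ∈ (0,1), there exists a reweighted subhypergraph H̃ = (V, Ẽ, w̃) of H with |Ẽ| ≤ C·n·log n·log r / ε² such that |cut_H(S) − cut_{H̃}(S)| ≤ ε · cut_H(S) for every S ⊆ V. -/

import Mathlib

open Matrix BigOperators

/-- The vector `δ_i - δ_j` in `ℝ^n`. -/
noncomputable def dvec {n : ℕ} (i j : Fin n) : Fin n → ℝ :=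
  fun k => (if k = i then (1 : ℝ) else 0) - (if k = j then (1 : ℝ) else 0)

/-- The rank-one matrix `(δ_i - δ_j)(δ_i - δ_j)ᵀ`, as a function of the unordered pair `{i,j}`. -/
noncomputable def edgeMat {n : ℕ} : Sym2 (Fin n) → Matrix (Fin n) (Fin n) ℝ :=
  Sym2.lift ⟨fun i j => Matrix.vecMulVec (dvec i j) (dvec i j), by
    intro i j
    ext a b
    simp [Matrix.vecMulVec_apply, dvec]
    ring⟩

/-- `M` is the Moore–Penrose pseudoinverse of `L` (the four Penrose equations). -/
def IsMP {n : ℕ} (L M : Matrix (Fin n) (Fin n) ℝ) : Prop :=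
  L * M * L = L ∧ M * L * M = M ∧ (L * M)ᵀ = L * M ∧ (M * L)ᵀ = M * L

/-- The Moore–Penrose pseudoinverse (chosen via the Penrose equations, which determine
it uniquely whenever it exists). -/
noncomputable def pinv {n : ℕ} (L : Matrix (Fin n) (Fin n) ℝ) : Matrix (Fin n) (Fin n) ℝ :=
  haveI := Classical.propDecidable (∃ M, IsMP L M)
  if h : ∃ M, IsMP L M then h.choose else 0

/-- Effective resistance `(δ_i - δ_j)ᵀ L⁺ (δ_i - δ_j)` of an unordered pair, given `L⁺`. -/
noncomputable def res {n : ℕ} (Lp : Matrix (Fin n) (Fin n) ℝ) : Sym2 (Fin n) → ℝ :=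
  Sym2.lift ⟨fun i j => dvec i j ⬝ᵥ (Lp *ᵥ dvec i j), by
    intro i j
    show dvec i j ⬝ᵥ (Lp *ᵥ dvec i j) = dvec j i ⬝ᵥ (Lp *ᵥ dvec j i)
    have h : dvec j i = -(dvec i j) := by
      funext k; simp [dvec, Pi.neg_apply]
    rw [h]
    simp [Matrix.mulVec_neg]⟩

/-- Laplacian of the weighted graph with edge set `F` and weights `c`. -/
noncomputable def lapG {n : ℕ} (F : Finset (Sym2 (Fin n))) (c : Sym2 (Fin n) → ℝ) :
    Matrix (Fin n) (Fin n) ℝ :=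
  ∑ f ∈ F, c f • edgeMat f

/-- The unordered pairs of distinct vertices contained in `e`. -/
def pairs {n : ℕ} (e : Finset (Fin n)) : Finset (Sym2 (Fin n)) :=
  e.sym2.filter fun f => ¬ f.IsDiag

/-- `Q_e(x) = max_{{i,j} ⊆ e} (x_i - x_j)²`. -/
noncomputable def Qe {n : ℕ} (x : Fin n → ℝ) (e : Finset (Fin n)) : ℝ :=
  ⨆ i ∈ e, ⨆ j ∈ e, (x i - x j) ^ 2

/-- The hypergraph energy `Q_H(x) = Σ_e w_e Q_e(x)`. -/
noncomputable def QH {n : ℕ} (E : Finset (Finset (Fin n))) (w : Finset (Fin n) → ℝ)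
    (x : Fin n → ℝ) : ℝ :=
  ∑ e ∈ E, w e * Qe x e

/-- Laplacian of the underlying (multi)graph of a hypergraph with weights `c e f`. -/
noncomputable def lapU {n : ℕ} (E : Finset (Finset (Fin n)))
    (c : Finset (Fin n) → Sym2 (Fin n) → ℝ) : Matrix (Fin n) (Fin n) ℝ :=
  ∑ e ∈ E, ∑ f ∈ pairs e, c e f • edgeMat f

/-- The cut value `cut_H(S) = Σ_{e : e∩S ≠ ∅, e∖S ≠ ∅} w_e` of a hypergraph. -/
noncomputable def cutH {n : ℕ} (E : Finset (Finset (Fin n))) (w : Finset (Fin n) → ℝ)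
    (S : Finset (Fin n)) : ℝ :=
  ∑ e ∈ E.filter (fun e => (e ∩ S).Nonempty ∧ (e \ S).Nonempty), w e

/-- Level sets of a lexicographically optimal base of the polymatroid of `f` are tight. -/
theorem exists_base_forall_levelSet_tight {ι : Type*} [DecidableEq ι] (w : ι → ℝ) (E : Finset ι) :
    ∀ (f : Finset ι → ℝ) (s₀ : ℝ), f ∅ = 0 →
      (∀ A B, f (A ∪ B) + f (A ∩ B) ≤ f A + f B) → (∀ e ∈ E, 0 < w e) →
      (∀ A ⊆ E, s₀ * ∑ e ∈ A, w e ≤ f A) →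
      ∃ u : ι → ℝ, (∀ e ∈ E, s₀ * w e ≤ u e) ∧ (∀ A ⊆ E, ∑ e ∈ A, u e ≤ f A) ∧
        ∀ t, ∑ e ∈ E with u e ≤ t * w e, u e = f {e ∈ E | u e ≤ t * w e} := by
  induction E using Finset.strongInduction with
  | H E ih =>
  intro f s₀ f0 hf hw hs
  obtain rfl | hE := E.eq_empty_or_nonempty
  · refine ⟨0, by simp, ?_, by simp [f0]⟩
    intro A hA
    simp [Finset.subset_empty.1 hA, f0]
  have hpos : ∀ A ⊆ E, A.Nonempty → 0 < ∑ e ∈ A, w e := fun A hA hne =>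
    Finset.sum_pos (fun e he => hw e (hA he)) hne
  obtain ⟨A, hA, hmin⟩ := (E.powerset.erase ∅).exists_min_image
    (fun A => f A / ∑ e ∈ A, w e) ⟨E, by simp [hE.ne_empty]⟩
  simp only [Finset.mem_erase, Finset.mem_powerset] at hA hmin
  obtain ⟨hA0, hAE⟩ := hA
  have hAne := Finset.nonempty_iff_ne_empty.2 hA0
  have hwA := hpos A hAE hAne
  set s := f A / ∑ e ∈ A, w e with hsdef
  have hsA : s * ∑ e ∈ A, w e = f A := div_mul_cancel₀ _ hwA.ne'
  have hss : s₀ ≤ s := (le_div_iff₀ hwA).2 (hs A hAE)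
  have hsB : ∀ B ⊆ E, s * ∑ e ∈ B, w e ≤ f B := by
    intro B hB
    obtain rfl | hBne := B.eq_empty_or_nonempty
    · simp [f0]
    · exact (le_div_iff₀ (hpos B hB hBne)).1 (hmin B ⟨hBne.ne_empty, hB⟩)
  obtain ⟨u, hu1, hu2, hu3⟩ := ih (E \ A) (Finset.sdiff_ssubset hAE hAne)
    (fun B => f (A ∪ B) - f A) s (by simp)
    (by
      intro B C
      have := hf (A ∪ B) (A ∪ C)
      rw [← Finset.union_union_distrib_left, ← Finset.union_inter_distrib_left] at this
      linarith)
    (fun e he => hw e (Finset.sdiff_subset he))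
    (by
      intro B hB
      have h1 := hsB (A ∪ B) (Finset.union_subset hAE (hB.trans Finset.sdiff_subset))
      rw [Finset.sum_union (Finset.disjoint_of_subset_right hB Finset.disjoint_sdiff), mul_add,
        hsA] at h1
      linarith)
  refine ⟨fun e => if e ∈ A then s * w e else u e, ?_, ?_, ?_⟩
  · intro e he
    have := hw e he
    dsimp only
    split_ifs with h
    · gcongr
    · exact (mul_le_mul_of_nonneg_right hss this.le).trans (hu1 e (by simp [he, h]))
  · intro B hB
    have h1 := hu2 (B \ A) (Finset.sdiff_subset_sdiff hB le_rfl)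
    have h2 := hsB (B ∩ A) (Finset.inter_subset_left.trans hB)
    have h3 := hf A B
    rw [← Finset.sum_inter_add_sum_sdiff B A,
      Finset.sum_congr rfl (fun e he => if_pos (Finset.mem_inter.1 he).2),
      Finset.sum_congr (s₁ := B \ A) rfl (fun e he => if_neg (Finset.mem_sdiff.1 he).2),
      ← Finset.mul_sum]
    simp only [Finset.union_sdiff_self_eq_union] at h1
    rw [Finset.inter_comm] at h2 ⊢
    linarith
  · intro t
    by_cases ht : s ≤ t
    · have hset : {e ∈ E | (if e ∈ A then s * w e else u e) ≤ t * w e} =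
          A ∪ {e ∈ E \ A | u e ≤ t * w e} := by
        ext e
        by_cases h : e ∈ A
        · simp [h, hAE h, mul_le_mul_of_nonneg_right ht (hw e (hAE h)).le]
        · simp [h]
      rw [hset, Finset.sum_union, Finset.sum_congr rfl (fun e he => if_pos he),
        ← Finset.mul_sum, hsA, Finset.sum_congr rfl (fun e he => if_neg
          (Finset.mem_sdiff.1 (Finset.mem_filter.1 he).1).2), hu3 t]
      · ring
      · exact Finset.disjoint_of_subset_right (Finset.filter_subset _ _) Finset.disjoint_sdiff
    · have hset : {e ∈ E | (if e ∈ A then s * w e else u e) ≤ t * w e} = ∅ := by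
        refine Finset.filter_eq_empty_iff.2 fun e he => ?_
        have h1 := mul_lt_mul_of_pos_right (not_le.1 ht) (hw e he)
        split_ifs with h
        · exact h1.not_ge
        · exact (h1.trans_le (hu1 e (by simp [he, h]))).not_ge
      rw [hset, f0, Finset.sum_empty]

/-- Abel summation: nonnegative sums over all superlevel sets of `κ` give a nonnegative
`κ`-weighted sum. -/
theorem sum_mul_nonneg_of_superlevel {ι : Type*} (κ d : ι → ℝ) (E : Finset ι) :
    ∀ c : ℝ, (∀ e ∈ E, c ≤ κ e) → (∀ e ∈ E, 0 ≤ ∑ e' ∈ E with κ e ≤ κ e', d e') →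
      0 ≤ ∑ e ∈ E, (κ e - c) * d e := by
  induction E using Finset.strongInduction with
  | H E ih =>
  intro c hc hd
  obtain rfl | hE := E.eq_empty_or_nonempty
  · simp
  obtain ⟨a, ha, hmin⟩ := E.exists_min_image κ hE
  have hEa := hd a ha
  rw [Finset.filter_true_of_mem hmin] at hEa
  have h1 := ih {e ∈ E | κ a < κ e}
    (Finset.filter_ssubset.2 ⟨a, ha, lt_irrefl _⟩) (κ a)
    (fun e he => (Finset.mem_filter.1 he).2.le)
    (by
      intro e he
      rw [Finset.mem_filter] at he
      convert hd e he.1 using 2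
      ext e'
      simp only [Finset.mem_filter]
      exact ⟨fun h => ⟨h.1.1, h.2⟩, fun h => ⟨⟨h.1, he.2.trans_le h.2⟩, h.2⟩⟩)
  have h2 : ∑ e ∈ E with κ a < κ e, (κ e - κ a) * d e = ∑ e ∈ E, (κ e - κ a) * d e := by
    refine Finset.sum_subset (Finset.filter_subset _ _) fun e he hne => ?_
    have : κ e = κ a := le_antisymm
      (not_lt.1 fun h => hne (Finset.mem_filter.2 ⟨he, h⟩)) (hmin e he)
    simp [this]
  have h3 : ∑ e ∈ E, (κ e - c) * d e
      = (κ a - c) * ∑ e ∈ E, d e + ∑ e ∈ E, (κ e - κ a) * d e := by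
    rw [Finset.mul_sum, ← Finset.sum_add_distrib]
    exact Finset.sum_congr rfl fun e _ => by ring
  rw [h3, ← h2]
  have := mul_nonneg (sub_nonneg.2 (hc a ha)) hEa
  linarith

/-- The probability of `T` when each `e ∈ E` is sampled independently with probability `p e`. -/
noncomputable def sampleProb {ι : Type*} [DecidableEq ι] (E : Finset ι) (p : ι → ℝ)
    (T : Finset ι) : ℝ :=
  (∏ e ∈ T, p e) * ∏ e ∈ E \ T, (1 - p e)

theorem sampleProb_nonneg {ι : Type*} [DecidableEq ι] {E : Finset ι} {p : ι → ℝ}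
    (h0 : ∀ e ∈ E, 0 ≤ p e) (h1 : ∀ e ∈ E, p e ≤ 1) {T : Finset ι} (hT : T ⊆ E) :
    0 ≤ sampleProb E p T :=
  mul_nonneg (Finset.prod_nonneg fun e he => h0 e (hT he))
    (Finset.prod_nonneg fun e he => sub_nonneg.2 (h1 e (Finset.sdiff_subset he)))

theorem sum_sampleProb_mul_prod {ι : Type*} [DecidableEq ι] (E : Finset ι) (p a b : ι → ℝ)
    {D : Finset ι} (hD : D ⊆ E) :
    ∑ T ∈ E.powerset, sampleProb E p T * ∏ e ∈ D, (if e ∈ T then a e else b e)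
      = ∏ e ∈ D, (p e * a e + (1 - p e) * b e) := by
  have h : ∀ c : ι → ℝ, ∏ e ∈ D, c e = ∏ e ∈ E, if e ∈ D then c e else 1 := by
    intro c
    rw [Finset.prod_ite_mem, Finset.inter_eq_right.2 hD]
  have h2 : ∀ e, (if e ∈ D then p e * a e + (1 - p e) * b e else 1)
      = p e * (if e ∈ D then a e else 1) + (1 - p e) * (if e ∈ D then b e else 1) := by
    intro e; split_ifs <;> ring
  rw [h, Finset.prod_congr rfl (fun e _ => h2 e), Finset.prod_add]
  refine Finset.sum_congr rfl fun T hT => ?_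
  rw [Finset.mem_powerset] at hT
  have ha : ∏ e ∈ T, (if e ∈ D then if e ∈ T then a e else b e else 1)
      = ∏ e ∈ T, if e ∈ D then a e else 1 :=
    Finset.prod_congr rfl fun e he => by rw [if_pos he]
  have hb : ∏ e ∈ E \ T, (if e ∈ D then if e ∈ T then a e else b e else 1)
      = ∏ e ∈ E \ T, if e ∈ D then b e else 1 :=
    Finset.prod_congr rfl fun e he => by rw [if_neg (Finset.mem_sdiff.1 he).2]
  rw [h, ← Finset.prod_sdiff hT, ha, hb, sampleProb, Finset.prod_mul_distrib,
    Finset.prod_mul_distrib]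
  ring

theorem sum_sampleProb {ι : Type*} [DecidableEq ι] (E : Finset ι) (p : ι → ℝ) :
    ∑ T ∈ E.powerset, sampleProb E p T = 1 := by
  simpa using sum_sampleProb_mul_prod E p 1 1 (Finset.empty_subset E)

theorem exists_le_of_sum_sampleProb_mul_le {ι : Type*} [DecidableEq ι] {E : Finset ι} {p : ι → ℝ}
    (h0 : ∀ e ∈ E, 0 ≤ p e) (h1 : ∀ e ∈ E, p e ≤ 1) (X : Finset ι → ℝ) {m : ℝ}
    (hX : ∑ T ∈ E.powerset, sampleProb E p T * X T ≤ m) : ∃ T ⊆ E, X T ≤ m := by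
  by_contra! hcon
  have hlt : ∑ T ∈ E.powerset, sampleProb E p T * m < ∑ T ∈ E.powerset, sampleProb E p T * X T := by
    refine Finset.sum_lt_sum (fun T hT => ?_) ?_
    · rw [Finset.mem_powerset] at hT
      exact mul_le_mul_of_nonneg_left (hcon T hT).le (sampleProb_nonneg h0 h1 hT)
    · obtain ⟨T, hT, hTpos⟩ : ∃ T ∈ E.powerset, 0 < sampleProb E p T := by
        by_contra! hn
        have := Finset.sum_nonpos hn
        rw [sum_sampleProb] at this
        linarith
      exact ⟨T, hT, mul_lt_mul_of_pos_left (hcon T (Finset.mem_powerset.1 hT)) hTpos⟩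
  rw [← Finset.sum_mul, sum_sampleProb] at hlt
  linarith

theorem sample_mgf_le {m θ : ℝ} (hm : 0 < m) (hθ : |θ| ≤ 1) :
    min 1 m * Real.exp (θ * (m / min 1 m - m)) + (1 - min 1 m) * Real.exp (θ * (0 - m))
      ≤ Real.exp (m * θ ^ 2) := by
  obtain h | h := le_total 1 m
  · rw [min_eq_left h]
    simp only [div_one, sub_self, mul_zero, Real.exp_zero, zero_mul, add_zero, mul_one]
    exact Real.one_le_exp (by positivity)
  · rw [min_eq_right h, div_self hm.ne']
    have e1 : Real.exp (θ * (1 - m)) = Real.exp (-(θ * m)) * Real.exp θ := by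
      rw [← Real.exp_add]; ring_nf
    have e2 : Real.exp (θ * (0 - m)) = Real.exp (-(θ * m)) := by ring_nf
    have e3 : m * (Real.exp θ - 1) + 1 ≤ Real.exp (m * (Real.exp θ - 1)) := Real.add_one_le_exp _
    have e4 := (abs_le.1 (Real.abs_exp_sub_one_sub_id_le hθ)).2
    calc _ = Real.exp (-(θ * m)) * (m * (Real.exp θ - 1) + 1) := by rw [e1, e2]; ring
      _ ≤ Real.exp (-(θ * m)) * Real.exp (m * (Real.exp θ - 1)) := by gcongr
      _ = Real.exp (m * (Real.exp θ - 1 - θ)) := by rw [← Real.exp_add]; ring_nf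
      _ ≤ _ := by gcongr

theorem sum_sampleProb_mul_exp_le {ι : Type*} [DecidableEq ι] {E : Finset ι} {u : ι → ℝ}
    (hu : ∀ e ∈ E, 0 < u e) {M θ : ℝ} (hM : 0 < M) (hθ : |θ| ≤ 1) {D : Finset ι} (hD : D ⊆ E) :
    ∑ T ∈ E.powerset, sampleProb E (fun e => min 1 (M * u e)) T *
        Real.exp (θ * M * ∑ e ∈ D, ((if e ∈ T then u e / min 1 (M * u e) else 0) - u e))
      ≤ Real.exp (M * θ ^ 2 * ∑ e ∈ D, u e) := by
  have h : ∀ T : Finset ι,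
      Real.exp (θ * M * ∑ e ∈ D, ((if e ∈ T then u e / min 1 (M * u e) else 0) - u e))
        = ∏ e ∈ D, if e ∈ T then Real.exp (θ * (M * u e / min 1 (M * u e) - M * u e))
            else Real.exp (θ * (0 - M * u e)) := by
    intro T
    rw [Finset.mul_sum, Real.exp_sum]
    refine Finset.prod_congr rfl fun e _ => ?_
    split_ifs <;> ring_nf
  simp only [h]
  rw [sum_sampleProb_mul_prod E _ _ _ hD, Finset.mul_sum, Real.exp_sum]
  refine Finset.prod_le_prod (fun e he => ?_) fun e he => ?_
  · have hm : 0 < M * u e := mul_pos hM (hu e (hD he))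
    have h1 : 0 ≤ min 1 (M * u e) := le_min zero_le_one hm.le
    have h2 : 0 ≤ 1 - min 1 (M * u e) := sub_nonneg.2 (min_le_left _ _)
    positivity
  · refine (sample_mgf_le (mul_pos hM (hu e (hD he))) hθ).trans_eq ?_
    ring_nf

theorem sum_sampleProb_mul_exp_card_le {ι : Type*} [DecidableEq ι] {E : Finset ι} {p : ι → ℝ}
    (h0 : ∀ e ∈ E, 0 ≤ p e) (h1 : ∀ e ∈ E, p e ≤ 1) :
    ∑ T ∈ E.powerset, sampleProb E p T * Real.exp T.card ≤ Real.exp (2 * ∑ e ∈ E, p e) := by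
  have h : ∀ T ∈ E.powerset, sampleProb E p T * Real.exp T.card
      = sampleProb E p T * ∏ e ∈ E, if e ∈ T then Real.exp 1 else 1 := by
    intro T hT
    rw [Finset.prod_ite_mem, Finset.inter_eq_right.2 (Finset.mem_powerset.1 hT),
      Finset.prod_const, ← Real.exp_nat_mul, mul_one]
  rw [Finset.sum_congr rfl h, sum_sampleProb_mul_prod E p _ _ le_rfl, Finset.mul_sum,
    Real.exp_sum]
  refine Finset.prod_le_prod (fun e he => ?_) fun e he => ?_
  · have h2 : 0 ≤ 1 - p e := sub_nonneg.2 (h1 e he)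
    have := h0 e he
    positivity
  · have h3 := Real.add_one_le_exp (2 * p e)
    have h4 := mul_le_mul_of_nonneg_left Real.exp_one_lt_three.le (h0 e he)
    linarith

theorem exists_sample {ι κ : Type*} [DecidableEq ι] {E : Finset ι} {u : ι → ℝ}
    (hu : ∀ e ∈ E, 0 < u e) {M ε : ℝ} (hM : 0 < M) (hε0 : 0 < ε) (hε1 : ε < 1)
    (J : Finset κ) (c : κ → ℝ) (hc : ∀ j ∈ J, 0 ≤ c j) (D : κ → Finset ι)
    (hD : ∀ j ∈ J, D j ⊆ E)
    (hsum : ∑ j ∈ J, c j * Real.exp (-(M * ε ^ 2 / 4 * ∑ e ∈ D j, u e)) ≤ 1 / 8) :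
    ∃ T ⊆ E, (T.card : ℝ) ≤ 2 * M * ∑ e ∈ E, u e + 1 ∧
      ∀ σ : ℝ, |σ| = 1 → ∑ j ∈ J, c j * Real.exp (σ * (ε / 2) * M *
          ∑ e ∈ D j, ((if e ∈ T then u e / min 1 (M * u e) else 0) - u e)
          - M * ε ^ 2 / 2 * ∑ e ∈ D j, u e) < 1 := by
  set p : ι → ℝ := fun e => min 1 (M * u e) with hp
  have h0 : ∀ e ∈ E, 0 ≤ p e := fun e he => le_min zero_le_one (mul_pos hM (hu e he)).le
  have h1 : ∀ e ∈ E, p e ≤ 1 := fun e he => min_le_left _ _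
  set G : ℝ → Finset ι → ℝ := fun σ T => ∑ j ∈ J, c j * Real.exp (σ * (ε / 2) * M *
          ∑ e ∈ D j, ((if e ∈ T then u e / min 1 (M * u e) else 0) - u e)
          - M * ε ^ 2 / 2 * ∑ e ∈ D j, u e) with hG
  have hG0 : ∀ σ T, 0 ≤ G σ T := fun σ T =>
    Finset.sum_nonneg fun j hj => mul_nonneg (hc j hj) (Real.exp_pos _).le
  have hGE : ∀ σ, |σ| = 1 → ∑ T ∈ E.powerset, sampleProb E p T * G σ T ≤ 1 / 8 := by
    intro σ hσ
    refine le_trans ?_ hsum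
    have hmul : ∀ T, sampleProb E p T * G σ T = ∑ j ∈ J, sampleProb E p T * (c j *
        Real.exp (σ * (ε / 2) * M *
          ∑ e ∈ D j, ((if e ∈ T then u e / min 1 (M * u e) else 0) - u e)
          - M * ε ^ 2 / 2 * ∑ e ∈ D j, u e)) := fun T => Finset.mul_sum _ _ _
    rw [Finset.sum_congr rfl fun T _ => hmul T, Finset.sum_comm]
    refine Finset.sum_le_sum fun j hj => ?_
    have hθ : |σ * (ε / 2)| ≤ 1 := by
      rw [abs_mul, hσ, abs_of_pos (by positivity)]; linarith
    have hσ2 : σ ^ 2 = 1 := by rw [← sq_abs, hσ, one_pow]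
    have key := sum_sampleProb_mul_exp_le hu hM hθ (hD j hj)
    calc _ = c j * Real.exp (-(M * ε ^ 2 / 2 * ∑ e ∈ D j, u e)) *
          ∑ T ∈ E.powerset, sampleProb E p T * Real.exp (σ * (ε / 2) * M *
            ∑ e ∈ D j, ((if e ∈ T then u e / min 1 (M * u e) else 0) - u e)) := by
          rw [Finset.mul_sum E.powerset]
          refine Finset.sum_congr rfl fun T _ => ?_
          rw [sub_eq_add_neg, Real.exp_add]
          ring
      _ ≤ c j * Real.exp (-(M * ε ^ 2 / 2 * ∑ e ∈ D j, u e)) *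
          Real.exp (M * (σ * (ε / 2)) ^ 2 * ∑ e ∈ D j, u e) :=
          mul_le_mul_of_nonneg_left key (mul_nonneg (hc j hj) (Real.exp_pos _).le)
      _ = _ := by
          rw [mul_assoc, ← Real.exp_add, mul_pow, hσ2]
          congr 2
          ring
  have hC : ∑ T ∈ E.powerset, sampleProb E p T *
      Real.exp (T.card - 2 * M * ∑ e ∈ E, u e - 1) ≤ 1 / 2 := by
    have h2 := sum_sampleProb_mul_exp_card_le h0 h1
    have h3 : ∑ e ∈ E, p e ≤ M * ∑ e ∈ E, u e := by
      rw [Finset.mul_sum]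
      exact Finset.sum_le_sum fun e _ => min_le_right _ _
    calc _ = (∑ T ∈ E.powerset, sampleProb E p T * Real.exp T.card) *
          Real.exp (-(2 * M * ∑ e ∈ E, u e) - 1) := by
          rw [Finset.sum_mul]
          refine Finset.sum_congr rfl fun T _ => ?_
          rw [mul_assoc (sampleProb E p T), ← Real.exp_add]
          congr 2
          ring
      _ ≤ Real.exp (2 * ∑ e ∈ E, p e) * Real.exp (-(2 * M * ∑ e ∈ E, u e) - 1) := by gcongr
      _ ≤ Real.exp (-1) := by
          rw [← Real.exp_add]
          gcongr
          linarith
      _ ≤ 1 / 2 := by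
          have := Real.exp_one_gt_d9
          rw [Real.exp_neg, one_div]
          gcongr
          linarith
  obtain ⟨T, hT, hXT⟩ := exists_le_of_sum_sampleProb_mul_le h0 h1
    (fun T => G 1 T + G (-1) T + Real.exp (T.card - 2 * M * ∑ e ∈ E, u e - 1)) (m := 3 / 4) (by
      simp only [mul_add, Finset.sum_add_distrib]
      have := hGE 1 (by simp)
      have := hGE (-1) (by simp)
      linarith)
  have hG1 := hG0 1 T
  have hG2 := hG0 (-1) T
  have he := Real.exp_pos (T.card - 2 * M * ∑ e ∈ E, u e - 1)
  refine ⟨T, hT, ?_, fun σ hσ => ?_⟩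
  · have : Real.exp (T.card - 2 * M * ∑ e ∈ E, u e - 1) ≤ 1 := by linarith
    rw [Real.exp_le_one_iff] at this
    linarith
  · change G σ T < 1
    rcases (abs_eq zero_le_one).1 hσ with rfl | rfl <;> linarith

open scoped Classical in
/-- Let `u` be a base of the rank polymatroid `A ↦ dim W - dim ⋂ e ∈ A, V e` on `F`. The partition
function of the cuts `{e ∈ F | x ∉ V e}` is dominated by that of independent elements. -/
theorem sum_exp_neg_cut_le {ι W : Type*} [AddCommGroup W] [Module (ZMod 2) W] [Fintype W]
    (V : ι → Submodule (ZMod 2) W) (F : Finset ι) (u : ι → ℝ) (hu : ∀ e ∈ F, 0 ≤ u e)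
    (hle : ∀ A ⊆ F, ∑ e ∈ A, u e ≤ Module.finrank (ZMod 2) W
      - (Module.finrank (ZMod 2) (A.inf V : Submodule (ZMod 2) W) : ℝ))
    (hF : ∑ e ∈ F, u e = Module.finrank (ZMod 2) W
      - (Module.finrank (ZMod 2) (F.inf V : Submodule (ZMod 2) W) : ℝ)) (k : ℕ) :
    ∀ A ⊆ F, Module.finrank (ZMod 2) (A.inf V : Submodule (ZMod 2) W)
        = Module.finrank (ZMod 2) (F.inf V : Submodule (ZMod 2) W) + k → ∀ β : ℝ, 0 ≤ β →
      ∑ x : W with x ∈ A.inf V, Real.exp (-(β * ∑ e ∈ F with x ∉ V e, u e))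
        ≤ 2 ^ Module.finrank (ZMod 2) (F.inf V : Submodule (ZMod 2) W)
          * (1 + Real.exp (-β)) ^ k := by
  have hcard : ∀ S : Submodule (ZMod 2) W,
      ((Finset.univ.filter (· ∈ S)).card : ℝ) = 2 ^ Module.finrank (ZMod 2) S := by
    intro S
    have := Module.card_eq_pow_finrank (K := ZMod 2) (V := S)
    rw [ZMod.card, Fintype.card_subtype] at this
    exact_mod_cast this
  induction k using Nat.strongRecOn with
  | ind k ih =>
  intro A hA hk β hβ
  set c := Module.finrank (ZMod 2) (F.inf V : Submodule (ZMod 2) W)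
  set U : W → ℝ := fun x => ∑ e ∈ F with x ∉ V e, u e with hU
  have hU0 : ∀ x, 0 ≤ U x := fun x =>
    Finset.sum_nonneg fun e he => hu e (Finset.mem_filter.1 he).1
  set Z : ℝ → ℝ := fun b => ∑ x : W with x ∈ A.inf V, Real.exp (-(b * U x)) with hZ
  obtain rfl | hkpos := Nat.eq_zero_or_pos k
  · calc _ ≤ ∑ x : W with x ∈ A.inf V, (1 : ℝ) := by
          refine Finset.sum_le_sum fun x _ => Real.exp_le_one_iff.2 ?_
          have := mul_nonneg hβ (hU0 x)
          linarith
      _ = _ := by rw [Finset.sum_const, nsmul_one, hcard, hk]; simp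
  set B := {e ∈ F | A.inf V ≤ V e} with hB
  have hBinf : B.inf V = A.inf V := by
    refine le_antisymm (Finset.inf_mono fun e he => ?_) (Finset.le_inf fun e he => ?_)
    · exact Finset.mem_filter.2 ⟨hA he, Finset.inf_le he⟩
    · exact (Finset.mem_filter.1 he).2
  set D := ∑ e ∈ F with ¬ A.inf V ≤ V e, u e with hD
  have hDk : (k : ℝ) ≤ D := by
    have h1 := hle B (Finset.filter_subset _ _)
    rw [hBinf, hk] at h1
    have h2 : ∑ e ∈ B, u e + D = ∑ e ∈ F, u e := Finset.sum_filter_add_sum_filter_not _ _ _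
    push_cast at h1
    linarith
  have hstep : ∀ e ∈ F, ¬ A.inf V ≤ V e → ∀ b : ℝ, 0 ≤ b →
      ∑ x : W with x ∈ A.inf V ∧ x ∈ V e, Real.exp (-(b * U x))
        ≤ 2 ^ c * (1 + Real.exp (-b)) ^ (k - 1) := by
    intro e he hne b hb
    have hins : (insert e A).inf V = V e ⊓ A.inf V := Finset.inf_insert
    have hsub : insert e A ⊆ F := Finset.insert_subset he hA
    have hlt : Module.finrank (ZMod 2) ((insert e A).inf V : Submodule (ZMod 2) W) < c + k := by
      rw [← hk]
      refine Submodule.finrank_lt_finrank_of_lt ?_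
      rw [hins]
      exact inf_lt_right.2 hne
    have hge : c ≤ Module.finrank (ZMod 2) ((insert e A).inf V : Submodule (ZMod 2) W) :=
      Submodule.finrank_mono (Finset.inf_mono hsub)
    have h := ih (Module.finrank (ZMod 2) ((insert e A).inf V : Submodule (ZMod 2) W) - c)
      (by omega) (insert e A) hsub (by omega) b hb
    have hset : (Finset.univ.filter fun x => x ∈ A.inf V ∧ x ∈ V e)
        = Finset.univ.filter fun x => x ∈ (insert e A).inf V := by
      ext x
      simp [hins, and_comm]
    rw [hset]
    exact h.trans (mul_le_mul_of_nonneg_left (pow_le_pow_right₀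
      (by linarith [Real.exp_pos (-b)]) (by omega)) (by positivity))
  have hident : ∀ b : ℝ, 0 ≤ b →
      D * Z b - D * (2 ^ c * (1 + Real.exp (-b)) ^ (k - 1))
        ≤ ∑ x : W with x ∈ A.inf V, U x * Real.exp (-(b * U x)) := by
    intro b hb
    have h1 : ∑ x : W with x ∈ A.inf V, U x * Real.exp (-(b * U x))
        = ∑ e ∈ F, u e * ∑ x : W with x ∈ A.inf V ∧ x ∉ V e, Real.exp (-(b * U x)) := by
      rw [hU]
      simp only [Finset.sum_mul, Finset.mul_sum]
      refine Finset.sum_comm' fun x e => ?_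
      simp only [Finset.mem_filter, Finset.mem_univ, true_and]
      tauto
    have h2 : ∀ e ∈ F, (if A.inf V ≤ V e then 0 else
        u e * (Z b - 2 ^ c * (1 + Real.exp (-b)) ^ (k - 1)))
          ≤ u e * ∑ x : W with x ∈ A.inf V ∧ x ∉ V e, Real.exp (-(b * U x)) := by
      intro e he
      split_ifs with hne
      · exact mul_nonneg (hu e he) (Finset.sum_nonneg fun x _ => (Real.exp_pos _).le)
      · refine mul_le_mul_of_nonneg_left ?_ (hu e he)
        have h3 : ∑ x : W with x ∈ A.inf V ∧ x ∈ V e, Real.exp (-(b * U x))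
            + ∑ x : W with x ∈ A.inf V ∧ x ∉ V e, Real.exp (-(b * U x)) = Z b := by
          rw [hZ, ← Finset.filter_filter, ← Finset.filter_filter]
          exact Finset.sum_filter_add_sum_filter_not _ _ _
        have := hstep e he hne b hb
        linarith
    rw [h1]
    refine le_trans (le_of_eq ?_) (Finset.sum_le_sum h2)
    rw [hD, ← mul_sub, Finset.sum_mul, Finset.sum_filter]
    exact Finset.sum_congr rfl fun e _ => by split_ifs <;> rfl
  set g : ℝ → ℝ := fun b => 2 ^ c * (1 + Real.exp (-b)) ^ k with hg
  have hderiv : ∀ b, HasDerivAt (fun b => Real.exp (D * b) * (g b - Z b))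
      (Real.exp (D * b) * D * (g b - Z b) + Real.exp (D * b) *
        (2 ^ c * (k * (1 + Real.exp (-b)) ^ (k - 1) * (-Real.exp (-b)))
          - ∑ x : W with x ∈ A.inf V, -(U x * Real.exp (-(b * U x))))) b := by
    intro b
    have hd1 : HasDerivAt (fun b => Real.exp (D * b)) (Real.exp (D * b) * D) b := by
      simpa using ((hasDerivAt_id b).const_mul D).exp
    have hd2 : HasDerivAt (fun b => Real.exp (-b)) (-Real.exp (-b)) b := by
      simpa using (hasDerivAt_id b).neg.exp
    have hd3 : HasDerivAt g
        (2 ^ c * (k * (1 + Real.exp (-b)) ^ (k - 1) * (-Real.exp (-b)))) b :=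
      ((hd2.const_add 1).pow k).const_mul _
    have hd4 : HasDerivAt Z (∑ x : W with x ∈ A.inf V, -(U x * Real.exp (-(b * U x)))) b := by
      refine HasDerivAt.fun_sum fun x _ => ?_
      have := ((hasDerivAt_id b).mul_const (U x)).neg.exp
      simpa [mul_comm] using this
    exact hd1.mul (hd3.sub hd4)
  have hmono : MonotoneOn (fun b => Real.exp (D * b) * (g b - Z b)) (Set.Ici 0) := by
    refine monotoneOn_of_deriv_nonneg (convex_Ici 0)
      (fun b _ => (hderiv b).continuousAt.continuousWithinAt)
      (fun b _ => (hderiv b).differentiableAt.differentiableWithinAt) fun b hb => ?_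
    rw [interior_Ici, Set.mem_Ioi] at hb
    rw [(hderiv b).deriv, Finset.sum_neg_distrib]
    have h1 := hident b hb.le
    have h2 : g b = 2 ^ c * (1 + Real.exp (-b)) ^ (k - 1) * (1 + Real.exp (-b)) := by
      rw [mul_assoc, ← pow_succ, Nat.sub_add_cancel hkpos]
    have h3 : 0 ≤ (D - k) * (2 ^ c * (1 + Real.exp (-b)) ^ (k - 1) * Real.exp (-b)) :=
      mul_nonneg (sub_nonneg.2 hDk) (by positivity)
    rw [mul_assoc, ← mul_add]
    refine mul_nonneg (Real.exp_pos _).le ?_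
    rw [h2]
    linarith
  have hfin := hmono (Set.mem_Ici.2 le_rfl) (Set.mem_Ici.2 hβ) hβ
  have hz0 : g 0 - Z 0 = 0 := by
    simp only [hg, hZ, zero_mul, neg_zero, Real.exp_zero, Finset.sum_const, nsmul_one, hcard, hk]
    rw [pow_add]
    norm_num
  simp only [hz0, mul_zero] at hfin
  have := nonneg_of_mul_nonneg_right hfin (Real.exp_pos _)
  exact sub_nonneg.1 this

open scoped Classical in
theorem sum_exp_neg_cut_ne_zero_le {ι W : Type*} [AddCommGroup W] [Module (ZMod 2) W] [Fintype W]
    (V : ι → Submodule (ZMod 2) W) (F : Finset ι) (u : ι → ℝ) (hu : ∀ e ∈ F, 0 ≤ u e)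
    (hle : ∀ A ⊆ F, ∑ e ∈ A, u e ≤ Module.finrank (ZMod 2) W
      - (Module.finrank (ZMod 2) (A.inf V : Submodule (ZMod 2) W) : ℝ))
    (hF : ∑ e ∈ F, u e = Module.finrank (ZMod 2) W
      - (Module.finrank (ZMod 2) (F.inf V : Submodule (ZMod 2) W) : ℝ)) {β : ℝ} (hβ : 0 ≤ β)
    (hβn : Module.finrank (ZMod 2) W * Real.exp (-β) ≤ 1) :
    ∑ x : W, (if x ∈ F.inf V then 0 else
        ((2 : ℝ) ^ Module.finrank (ZMod 2) (F.inf V : Submodule (ZMod 2) W))⁻¹) *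
          Real.exp (-(β * ∑ e ∈ F with x ∉ V e, u e))
      ≤ 2 * (Module.finrank (ZMod 2) W * Real.exp (-β)) := by
  set n := Module.finrank (ZMod 2) W
  set c := Module.finrank (ZMod 2) (F.inf V : Submodule (ZMod 2) W) with hc
  have hcn : c ≤ n := Submodule.finrank_le _
  have hq := Real.exp_pos (-β)
  have h1 := sum_exp_neg_cut_le V F u hu hle hF (n - c) ∅ (Finset.empty_subset _)
    (by rw [Finset.inf_empty, finrank_top]; omega) β hβ
  simp only [Finset.inf_empty, Submodule.mem_top, Finset.filter_true] at h1
  have h2 : ∑ x : W with x ∈ F.inf V, Real.exp (-(β * ∑ e ∈ F with x ∉ V e, u e)) = 2 ^ c := by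
    have hcard := Module.card_eq_pow_finrank (K := ZMod 2) (V := (F.inf V : Submodule (ZMod 2) W))
    rw [ZMod.card, Fintype.card_subtype, ← hc] at hcard
    have hcard' : ((Finset.univ.filter (· ∈ F.inf V)).card : ℝ) = 2 ^ c := by exact_mod_cast hcard
    rw [← hcard', ← nsmul_one, ← Finset.sum_const]
    refine Finset.sum_congr rfl fun x hx => ?_
    rw [Finset.filter_false_of_mem fun e he => not_not.2
      (Finset.inf_le (f := V) he (Finset.mem_filter.1 hx).2)]
    simp
  have h3 : (1 + Real.exp (-β)) ^ (n - c) ≤ 1 + 2 * (n * Real.exp (-β)) := by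
    have h4 : (1 + Real.exp (-β)) ^ (n - c) ≤ Real.exp (n * Real.exp (-β)) := by
      calc (1 + Real.exp (-β)) ^ (n - c) ≤ (1 + Real.exp (-β)) ^ n :=
            pow_le_pow_right₀ (by linarith) (Nat.sub_le _ _)
        _ ≤ Real.exp (Real.exp (-β)) ^ n := by
            gcongr
            rw [add_comm]
            exact Real.add_one_le_exp _
        _ = _ := by rw [← Real.exp_nat_mul]
    have h0 : 0 ≤ n * Real.exp (-β) := by positivity
    have h5 := (abs_le.1 (Real.abs_exp_sub_one_le (x := n * Real.exp (-β))
      (by rwa [abs_of_nonneg h0]))).2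
    rw [abs_of_nonneg h0] at h5
    linarith
  have h6 : ∑ x : W with x ∉ F.inf V, Real.exp (-(β * ∑ e ∈ F with x ∉ V e, u e))
      ≤ 2 ^ c * (2 * (n * Real.exp (-β))) := by
    rw [← Finset.sum_filter_add_sum_filter_not Finset.univ (fun x : W => x ∈ F.inf V), h2] at h1
    have := mul_le_mul_of_nonneg_left h3 (pow_nonneg zero_le_two c : (0 : ℝ) ≤ 2 ^ c)
    linarith
  calc _ = (2 ^ c)⁻¹ * ∑ x : W with x ∉ F.inf V,
        Real.exp (-(β * ∑ e ∈ F with x ∉ V e, u e)) := by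
        rw [Finset.mul_sum, Finset.sum_filter]
        exact Finset.sum_congr rfl fun x _ => by split_ifs <;> simp_all
    _ ≤ _ := by
        rw [inv_mul_le_iff₀ (by positivity)]
        exact h6

open scoped Classical in
/-- A function of the cut of `x` that is small on average over each coset of `F.inf V` is small. -/
theorem le_sum_of_cut_invariant {ι W : Type*} [AddCommGroup W] [Module (ZMod 2) W] [Fintype W]
    (V : ι → Submodule (ZMod 2) W) (F : Finset ι) (G : Finset ι → ℝ) (hG : ∀ A, 0 ≤ G A) {x : W}
    (hx : x ∉ F.inf V) :
    G {e ∈ F | x ∉ V e} ≤ ∑ y : W, (if y ∈ F.inf V then 0 else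
        ((2 : ℝ) ^ Module.finrank (ZMod 2) (F.inf V : Submodule (ZMod 2) W))⁻¹) *
          G {e ∈ F | y ∉ V e} := by
  set c := Module.finrank (ZMod 2) (F.inf V : Submodule (ZMod 2) W) with hc
  have hcard := Module.card_eq_pow_finrank (K := ZMod 2) (V := (F.inf V : Submodule (ZMod 2) W))
  rw [ZMod.card, Fintype.card_subtype, ← hc] at hcard
  have hmem : ∀ v ∈ F.inf V, x + v ∉ F.inf V := fun v hv h =>
    hx ((Submodule.add_mem_iff_left _ hv).1 h)
  have hcut : ∀ v ∈ F.inf V, {e ∈ F | x + v ∉ V e} = {e ∈ F | x ∉ V e} := fun v hv =>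
    Finset.filter_congr fun e he => not_congr
      (Submodule.add_mem_iff_left _ (Finset.inf_le (f := V) he hv))
  calc G {e ∈ F | x ∉ V e}
      = ∑ v : W with v ∈ F.inf V, ((2 : ℝ) ^ c)⁻¹ * G {e ∈ F | x ∉ V e} := by
        rw [Finset.sum_const, hcard, nsmul_eq_mul, ← mul_assoc]
        push_cast
        rw [mul_inv_cancel₀ (by positivity), one_mul]
    _ = ∑ v : W with v ∈ F.inf V, (if x + v ∈ F.inf V then 0 else ((2 : ℝ) ^ c)⁻¹) *
          G {e ∈ F | x + v ∉ V e} := by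
        refine Finset.sum_congr rfl fun v hv => ?_
        have hv := (Finset.mem_filter.1 hv).2
        rw [if_neg (hmem v hv), hcut v hv]
    _ ≤ ∑ v : W, (if x + v ∈ F.inf V then 0 else ((2 : ℝ) ^ c)⁻¹) *
          G {e ∈ F | x + v ∉ V e} := by
        refine Finset.sum_le_sum_of_subset_of_nonneg (Finset.filter_subset _ _) fun v _ _ => ?_
        refine mul_nonneg ?_ (hG _)
        split_ifs <;> positivity
    _ = _ := Equiv.sum_comp (Equiv.addLeft x) fun y => (if y ∈ F.inf V then 0 else
          ((2 : ℝ) ^ c)⁻¹) * G {e ∈ F | y ∉ V e}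

open scoped Classical in
theorem finrank_inf_union_add_inter_ge {ι W : Type*} [AddCommGroup W] [Module (ZMod 2) W]
    [Fintype W] (V : ι → Submodule (ZMod 2) W) (A B : Finset ι) :
    Module.finrank (ZMod 2) (A.inf V : Submodule (ZMod 2) W)
        + Module.finrank (ZMod 2) (B.inf V : Submodule (ZMod 2) W)
      ≤ Module.finrank (ZMod 2) ((A ∪ B).inf V : Submodule (ZMod 2) W)
        + Module.finrank (ZMod 2) ((A ∩ B).inf V : Submodule (ZMod 2) W) := by
  rw [← Submodule.finrank_sup_add_finrank_inf_eq, ← Finset.inf_union, add_comm]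
  gcongr
  exact Submodule.finrank_mono (sup_le (Finset.inf_mono Finset.inter_subset_left)
    (Finset.inf_mono Finset.inter_subset_right))

open scoped Classical in
/-- Sparsification of the cuts `{e ∈ E | x ∉ V e}` of a weighted family of proper subspaces of a
binary vector space. -/
theorem exists_subspace_sparsifier {ι W : Type*} [AddCommGroup W] [Module (ZMod 2) W] [Fintype W]
    (V : ι → Submodule (ZMod 2) W) (E : Finset ι) (w : ι → ℝ) (hw : ∀ e ∈ E, 0 < w e)
    (hV : ∀ e ∈ E, V e ≠ ⊤) {n : ℕ} (hn : Module.finrank (ZMod 2) W = n) (hn2 : 2 ≤ n)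
    {ε : ℝ} (hε0 : 0 < ε) (hε1 : ε < 1) :
    ∃ T ⊆ E, ∃ t : ι → ℝ, (∀ e ∈ E, 0 ≤ t e) ∧ (∀ e, e ∉ T → t e = 0) ∧
      (T.card : ℝ) ≤ 48 * n * Real.log n / ε ^ 2 + 1 ∧
      ∀ x : W, |∑ e ∈ E with x ∉ V e, w e - ∑ e ∈ E with x ∉ V e, t e|
        ≤ ε * ∑ e ∈ E with x ∉ V e, w e := by
  set d : Finset ι → ℕ := fun A => Module.finrank (ZMod 2) (A.inf V : Submodule (ZMod 2) W) with hd
  have hdlt : ∀ A ⊆ E, A.Nonempty → d A < n := by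
    rintro A hA ⟨e, he⟩
    rw [← hn]
    exact Submodule.finrank_lt ((Finset.inf_le (f := V) he).trans_lt (hV e (hA he)).lt_top).ne
  have hd0 : d ∅ = n := by
    rw [← hn, hd]
    dsimp only
    rw [Finset.inf_empty, finrank_top]
  have hwE : 0 ≤ ∑ e ∈ E, w e := Finset.sum_nonneg fun e he => (hw e he).le
  obtain ⟨u, hu1, hu2, hu3⟩ := exists_base_forall_levelSet_tight w E
    (fun A => (n : ℝ) - d A) (1 + ∑ e ∈ E, w e)⁻¹
    (by simp [hd0]) (fun A B => by
      have : ((d A + d B : ℕ) : ℝ) ≤ ((d (A ∪ B) + d (A ∩ B) : ℕ) : ℝ) :=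
        Nat.cast_le.2 (finrank_inf_union_add_inter_ge V A B)
      push_cast at this
      linarith) hw (fun A hA => by
      obtain rfl | hne := A.eq_empty_or_nonempty
      · simp [hd0]
      have h1 : ((d A + 1 : ℕ) : ℝ) ≤ n := Nat.cast_le.2 (hdlt A hA hne)
      have h2 : ∑ e ∈ A, w e ≤ ∑ e ∈ E, w e :=
        Finset.sum_le_sum_of_subset_of_nonneg hA fun e he _ => (hw e he).le
      have h3 : (1 + ∑ e ∈ E, w e)⁻¹ * ∑ e ∈ A, w e ≤ 1 := by
        rw [inv_mul_le_iff₀ (by linarith)]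
        linarith
      push_cast at h1
      linarith)
  have hu : ∀ e ∈ E, 0 < u e := fun e he =>
    (mul_pos (inv_pos.2 (by linarith)) (hw e he)).trans_le (hu1 e he)
  set L : ι → Finset ι := fun a => {e ∈ E | u e ≤ u a / w a * w e} with hL
  have hLE : ∀ a, L a ⊆ E := fun a => Finset.filter_subset _ _
  have haL : ∀ a ∈ E, a ∈ L a := fun a ha =>
    Finset.mem_filter.2 ⟨ha, (div_mul_cancel₀ _ (hw a ha).ne').ge⟩
  have hchain : ∀ a b, L a ⊆ L b ∨ L b ⊆ L a := by
    intro a b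
    have key : ∀ a b, u a / w a ≤ u b / w b → L a ⊆ L b := fun a b h e he => by
      rw [hL, Finset.mem_filter] at he ⊢
      exact ⟨he.1, he.2.trans (mul_le_mul_of_nonneg_right h (hw e he.1).le)⟩
    exact (le_total (u a / w a) (u b / w b)).imp (key a b) (key b a)
  have hcardL : (E.image L).card ≤ n := by
    rw [← Finset.card_range n]
    refine Finset.card_le_card_of_injOn d (fun A hA => ?_) fun A hA B hB hAB => ?_
    · obtain ⟨a, ha, rfl⟩ := Finset.mem_image.1 (Finset.mem_coe.1 hA)
      exact Finset.mem_coe.2 (Finset.mem_range.2 (hdlt _ (hLE a) ⟨a, haL a ha⟩))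
    · obtain ⟨a, ha, rfl⟩ := Finset.mem_image.1 (Finset.mem_coe.1 hA)
      obtain ⟨b, hb, rfl⟩ := Finset.mem_image.1 (Finset.mem_coe.1 hB)
      have hsum : ∑ e ∈ L a, u e = ∑ e ∈ L b, u e := by
        rw [hL, hu3, hu3]
        exact congrArg (fun m : ℕ => (n : ℝ) - m) hAB
      have key : ∀ a b, L a ⊆ L b → ∑ e ∈ L a, u e = ∑ e ∈ L b, u e → L a = L b := by
        intro a b hab hs
        by_contra hne
        obtain ⟨e, he, hea⟩ := Finset.exists_of_ssubset (hab.ssubset_of_ne hne)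
        exact (Finset.sum_lt_sum_of_subset hab he hea (hu e (hLE b he))
          fun e he _ => (hu e (hLE b he)).le).ne hs
      exact (hchain a b).elim (fun h => key a b h hsum) fun h => (key b a h hsum.symm).symm
  have hn0 : (0 : ℝ) < n := by positivity
  have hn2' : (2 : ℝ) ≤ n := by exact_mod_cast hn2
  have hlog : 0 < Real.log n := Real.log_pos (by linarith)
  set M := 24 * Real.log n / ε ^ 2 with hM
  have hMpos : 0 < M := by positivity
  have hβ : M * ε ^ 2 / 4 = 6 * Real.log n := by
    rw [hM]; field_simp; norm_num
  have hq : Real.exp (-(6 * Real.log n)) = ((n : ℝ) ^ 6)⁻¹ := by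
    rw [Real.exp_neg, show (6 : ℝ) * Real.log n = ((6 : ℕ) : ℝ) * Real.log n by norm_num,
      Real.exp_nat_mul, Real.exp_log hn0]
  have hnq : (n : ℝ) * (2 * (n * ((n : ℝ) ^ 6)⁻¹)) ≤ 1 / 8 := by
    have h1 : (n : ℝ) * (2 * (n * ((n : ℝ) ^ 6)⁻¹)) = 2 / (n : ℝ) ^ 4 := by field_simp
    have h2 : (2 : ℝ) ^ 4 ≤ (n : ℝ) ^ 4 := by gcongr
    rw [h1, div_le_div_iff₀ (by positivity) (by norm_num)]
    linarith
  have hnq1 : (n : ℝ) * ((n : ℝ) ^ 6)⁻¹ ≤ 1 := by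
    have h0 : 0 ≤ (n : ℝ) * ((n : ℝ) ^ 6)⁻¹ := by positivity
    nlinarith
  set c : Finset ι × W → ℝ := fun j => if j.2 ∈ j.1.inf V then 0 else ((2 : ℝ) ^ d j.1)⁻¹ with hc
  set D : Finset ι × W → Finset ι := fun j => {e ∈ j.1 | j.2 ∉ V e} with hD
  have hc0 : ∀ j, 0 ≤ c j := fun j => by
    rw [hc]; dsimp only; split_ifs <;> positivity
  obtain ⟨T, hTE, hTcard, hT⟩ := exists_sample hu hMpos hε0 hε1 (E.image L ×ˢ Finset.univ) c
    (fun j _ => hc0 j) D (fun j hj => by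
      obtain ⟨a, -, ha⟩ := Finset.mem_image.1 (Finset.mem_product.1 hj).1
      exact (Finset.filter_subset _ _).trans (ha ▸ hLE a)) (by
      refine le_trans ?_ hnq
      rw [Finset.sum_product]
      calc _ ≤ ∑ F ∈ E.image L, 2 * (n * ((n : ℝ) ^ 6)⁻¹) := by
            refine Finset.sum_le_sum fun F hF => ?_
            obtain ⟨a, -, rfl⟩ := Finset.mem_image.1 hF
            have h := sum_exp_neg_cut_ne_zero_le V (L a) u (fun e he => (hu e (hLE a he)).le)
              (fun A hA => by rw [hn]; exact hu2 A (hA.trans (hLE a)))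
              (by rw [hn]; exact hu3 _) (β := 6 * Real.log n) (by positivity)
              (by rw [hn, hq]; exact hnq1)
            rw [hn, hq, ← hβ] at h
            exact h
        _ ≤ _ := by
            rw [Finset.sum_const, nsmul_eq_mul]
            gcongr)
  have hp : ∀ e ∈ E, 0 < min 1 (M * u e) := fun e he =>
    lt_min one_pos (mul_pos hMpos (hu e he))
  set y : ι → ℝ := fun e => if e ∈ T then u e / min 1 (M * u e) else 0 with hy
  have hlevel : ∀ a ∈ E, ∀ x : W, ∀ σ : ℝ, |σ| = 1 →
      σ * ∑ e ∈ L a with x ∉ V e, (y e - u e) ≤ ε * ∑ e ∈ L a with x ∉ V e, u e := by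
    intro a ha x σ hσ
    by_cases hx : x ∈ (L a).inf V
    · rw [Finset.filter_false_of_mem fun e he => not_not.2 (Finset.inf_le (f := V) he hx)]
      simp
    set G : Finset ι → ℝ := fun A => Real.exp (σ * (ε / 2) * M * ∑ e ∈ A, (y e - u e)
      - M * ε ^ 2 / 2 * ∑ e ∈ A, u e) with hG
    have h1 := le_sum_of_cut_invariant V (L a) G (fun A => (Real.exp_pos _).le) hx
    have h2 := hT σ hσ
    rw [Finset.sum_product] at h2
    have h3 := Finset.single_le_sum (f := fun F => ∑ x : W, c (F, x) * G (D (F, x)))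
      (fun F _ => Finset.sum_nonneg fun x _ => mul_nonneg (hc0 _) (Real.exp_pos _).le)
      (Finset.mem_image_of_mem L ha)
    have h4 := (h1.trans h3).trans_lt h2
    rw [hG, Real.exp_lt_one_iff] at h4
    have h5 : 0 < ε / 2 * M := by positivity
    refine le_of_mul_le_mul_left ?_ h5
    linarith
  refine ⟨T, hTE, fun e => w e / u e * y e, fun e he => ?_, fun e he => by simp [hy, he], ?_, ?_⟩
  · have h1 := hw e he
    have h2 := hu e he
    have h3 := hp e he
    have h4 : 0 ≤ y e := by rw [hy]; dsimp only; split_ifs <;> positivity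
    positivity
  · have h1 := hu2 E le_rfl
    have h2 : ∑ e ∈ E, u e ≤ n := h1.trans (sub_le_self _ (Nat.cast_nonneg _))
    calc (T.card : ℝ) ≤ 2 * M * ∑ e ∈ E, u e + 1 := hTcard
      _ ≤ 2 * M * n + 1 := by gcongr
      _ = _ := by rw [hM]; ring
  · intro x
    have key : ∀ σ : ℝ, |σ| = 1 →
        0 ≤ ∑ e ∈ E with x ∉ V e, (w e / u e - 0) * (ε * u e - σ * (y e - u e)) := by
      intro σ hσ
      refine sum_mul_nonneg_of_superlevel _ _ _ 0 (fun e he => ?_) fun a ha => ?_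
      · have he := (Finset.mem_filter.1 he).1
        exact (div_pos (hw e he) (hu e he)).le
      · have ha := (Finset.mem_filter.1 ha).1
        have hset : Finset.filter (fun e => w a / u a ≤ w e / u e) {e ∈ E | x ∉ V e}
            = {e ∈ L a | x ∉ V e} := by
          ext e
          simp only [hL, Finset.mem_filter, and_assoc]
          refine and_congr_right fun he => ?_
          rw [and_comm, div_le_div_iff₀ (hu a ha) (hu e he), div_mul_eq_mul_div,
            le_div_iff₀ (hw a ha), mul_comm (w a), mul_comm (w e)]
        rw [hset, Finset.sum_sub_distrib, ← Finset.mul_sum, ← Finset.mul_sum]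
        exact sub_nonneg.2 (hlevel a ha x σ hσ)
    have hexp : ∀ σ : ℝ, ∑ e ∈ E with x ∉ V e, (w e / u e - 0) * (ε * u e - σ * (y e - u e))
        = ε * ∑ e ∈ E with x ∉ V e, w e
          + σ * (∑ e ∈ E with x ∉ V e, w e - ∑ e ∈ E with x ∉ V e, w e / u e * y e) := by
      intro σ
      rw [← Finset.sum_sub_distrib, Finset.mul_sum, Finset.mul_sum, ← Finset.sum_add_distrib]
      refine Finset.sum_congr rfl fun e he => ?_
      have := (hu e (Finset.mem_filter.1 he).1).ne'
      field_simp
      ring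
    have h1 := key 1 (by simp)
    have h2 := key (-1) (by simp)
    rw [hexp] at h1 h2
    rw [abs_le]
    constructor <;> linarith

/-- The vectors that are constant on `e`. -/
def constOn {α : Type*} (e : Finset α) : Submodule (ZMod 2) (α → ZMod 2) where
  carrier := {x | ∀ i ∈ e, ∀ j ∈ e, x i = x j}
  add_mem' hx hy i hi j hj := by simp [hx i hi j hj, hy i hi j hj]
  zero_mem' := by simp
  smul_mem' a x hx i hi j hj := by simp [hx i hi j hj]

theorem indicator_notMem_constOn_iff {α : Type*} [DecidableEq α] (e S : Finset α) :
    (fun i => if i ∈ S then (1 : ZMod 2) else 0) ∉ constOn e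
      ↔ (e ∩ S).Nonempty ∧ (e \ S).Nonempty := by
  constructor
  · intro h
    by_contra hcon
    refine h fun i hi j hj => ?_
    by_cases hiS : i ∈ S <;> by_cases hjS : j ∈ S
    · simp [hiS, hjS]
    · exact (hcon ⟨⟨i, by simp [hi, hiS]⟩, ⟨j, by simp [hj, hjS]⟩⟩).elim
    · exact (hcon ⟨⟨j, by simp [hj, hjS]⟩, ⟨i, by simp [hi, hiS]⟩⟩).elim
    · simp [hiS, hjS]
  · rintro ⟨⟨i, hi⟩, ⟨j, hj⟩⟩ h
    rw [Finset.mem_inter] at hi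
    rw [Finset.mem_sdiff] at hj
    simpa [hi.2, hj.2] using h i hi.1 j hj.1

theorem constOn_ne_top {α : Type*} [DecidableEq α] {e : Finset α} (he : 2 ≤ e.card) :
    constOn e ≠ ⊤ := by
  obtain ⟨i, hi, j, hj, hij⟩ := Finset.one_lt_card.1 he
  intro h
  refine (indicator_notMem_constOn_iff e {i}).2 ⟨⟨i, by simp [hi]⟩, ⟨j, ?_⟩⟩ (h ▸ Submodule.mem_top)
  simp [hj, hij.symm]

/-- **Existence of near-linear-size hypergraph cut sparsifiers.** There is a universal
constant `C > 0` such that every weighted hypergraph with `n ≥ 2` vertices, rank `r ≥ 2`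
and nonnegative weights admits, for every `ε ∈ (0,1)`, a reweighted subhypergraph with at
most `C·n·log n·log r/ε²` hyperedges whose cut values approximate all cut values of `H`
within relative error `ε`. -/
theorem exists_hypergraph_cut_sparsifier :
    ∃ C : ℝ, 0 < C ∧
      ∀ (n : ℕ), 2 ≤ n →
      ∀ (E : Finset (Finset (Fin n))) (w : Finset (Fin n) → ℝ),
      (∀ e ∈ E, 2 ≤ e.card) → (∀ e ∈ E, 0 ≤ w e) →
      ∀ r : ℕ, 2 ≤ r → E.sup Finset.card = r →
      ∀ ε : ℝ, 0 < ε → ε < 1 →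
      ∃ tw : Finset (Fin n) → ℝ,
        (∀ e, 0 ≤ tw e) ∧ (∀ e, tw e ≠ 0 → e ∈ E) ∧
        ((E.filter (fun e => 0 < tw e)).card : ℝ)
          ≤ C * n * Real.log n * Real.log r / ε ^ 2 ∧
        ∀ S : Finset (Fin n), |cutH E w S - cutH E tw S| ≤ ε * cutH E w S := by
  refine ⟨100, by norm_num, fun n hn E w hE hw r hr _ ε hε0 hε1 => ?_⟩
  obtain ⟨T, hTE, t, ht0, htT, hcard, hcut⟩ := exists_subspace_sparsifier
    (fun e : Finset (Fin n) => constOn e) {e ∈ E | 0 < w e} w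
    (fun e he => (Finset.mem_filter.1 he).2)
    (fun e he => constOn_ne_top (hE e (Finset.mem_filter.1 he).1))
    (Module.finrank_fin_fun (ZMod 2)) hn hε0 hε1
  have hTE' : ∀ e ∈ T, e ∈ E := fun e he => (Finset.mem_filter.1 (hTE he)).1
  refine ⟨t, fun e => ?_, fun e he => ?_, ?_, fun S => ?_⟩
  · by_cases he : e ∈ T
    · exact ht0 e (hTE he)
    · exact (htT e he).ge
  · by_contra h
    exact he (htT e fun hT => h (hTE' e hT))
  · have hsub : E.filter (fun e => 0 < t e) ⊆ T := fun e he => by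
      by_contra h
      exact (Finset.mem_filter.1 he).2.ne' (htT e h)
    have h1 : ((E.filter (fun e => 0 < t e)).card : ℝ) ≤ T.card := by
      exact_mod_cast Finset.card_le_card hsub
    have hn2 : (2 : ℝ) ≤ n := by exact_mod_cast hn
    have hr2 : (2 : ℝ) ≤ r := by exact_mod_cast hr
    have hlogn : Real.log 2 ≤ Real.log n := Real.log_le_log two_pos hn2
    have hlogr : Real.log 2 ≤ Real.log r := Real.log_le_log two_pos hr2
    have hlog2 := Real.log_two_gt_d9
    have h2 : 1 ≤ n * Real.log n := by nlinarith
    have h3 : n * Real.log n ≤ n * Real.log n / ε ^ 2 :=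
      le_div_self (by linarith) (by positivity) (by nlinarith)
    have h4 : 100 * n * Real.log n * Real.log r / ε ^ 2
        = 100 * (n * Real.log n / ε ^ 2) * Real.log r := by ring
    have h5 : 48 * n * Real.log n / ε ^ 2 = 48 * (n * Real.log n / ε ^ 2) := by ring
    rw [h5] at hcard
    rw [h4]
    nlinarith
  · have key : ∀ v : Finset (Fin n) → ℝ, (∀ e ∈ E, ¬ 0 < w e → v e = 0) →
        cutH E v S = ∑ e ∈ {e ∈ E | 0 < w e} with
          (e ∩ S).Nonempty ∧ (e \ S).Nonempty, v e := by
      intro v hv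
      rw [cutH]
      rw [Finset.filter_comm]
      refine (Finset.sum_filter_of_ne fun e he hne => ?_).symm
      by_contra h
      exact hne (hv e (Finset.mem_filter.1 he).1 h)
    rw [key w fun e he h => le_antisymm (not_lt.1 h) (hw e he),
      key t fun e _ h => htT e fun hT => h (Finset.mem_filter.1 (hTE hT)).2]
    have h := hcut fun i => if i ∈ S then (1 : ZMod 2) else 0
    simp only [indicator_notMem_constOn_iff] at h
    convert h
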